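/- Let f_{n̄_1}(x) := (D_{2^{n_1+1}}(x^1) − D_{2^{n_1}}(x^1)) · Π_{j=2}^d w_{2^{n_j}−1}(x^j). Then its rectangular Walsh–Kaczmarz partial sums are: S_j^κ(f_{n̄_1}, x) = (D_{j_1}^κ(x^1) − D_{2^{n_1}}(x^1)) · Π_{l=2}^d w_{2^{n_l}−1}(x^l) if 2^{n_1}+1 ≤ j_1 ≤ 2^{n_1+1}−1 and j_l ≥ 2^{n_l} for all l = 2,…,d; S_j^κ(f_{n̄_1}, x) = f_{n̄_1}(x) if j_1 ≥ 2^{n_1+1} and j_l ≥ 2^{n_l} for all l = 2,…,d; and S_j^κ(f_{n̄_1}, x) = 0 otherwise. -/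

import Mathlib

open MeasureTheory Filter Finset ENNReal

noncomputable section

/-- The Walsh group `G`: countable product of copies of `ℤ/2ℤ`. -/
abbrev WG : Type := ℕ → ZMod 2

/-- The normalized Haar measure (= product of uniform coin-toss measures) on `G`. -/
def μW : Measure WG := Measure.addHaarMeasure ⊤

instance : (μW).Regular := by unfold μW; infer_instance

instance : IsFiniteMeasure μW := by
  constructor
  rw [← TopologicalSpace.PositiveCompacts.coe_top (α := WG)]
  exact IsCompact.measure_lt_top (⊤ : TopologicalSpace.PositiveCompacts WG).isCompact

/-- The product measure on `G^d`. -/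
def μD (d : ℕ) : Measure (Fin d → WG) := Measure.pi fun _ => μW

/-- The `k`-th Rademacher function. -/
def rad (k : ℕ) (x : WG) : ℝ := (-1 : ℝ) ^ (x k).val

/-- The Walsh–Paley function of index `n`. -/
def walsh (n : ℕ) (x : WG) : ℝ :=
  ∏ k ∈ Finset.range n.size, if n.testBit k then rad k x else 1

/-- The Walsh–Kaczmarz function of index `n`; `Nat.log 2 n` is the order `|n|`. -/
def kacz (n : ℕ) (x : WG) : ℝ :=
  if n = 0 then 1 else
    rad (Nat.log 2 n) x *
      (-1 : ℝ) ^ (∑ k ∈ Finset.range (Nat.log 2 n),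
        (if n.testBit k then 1 else 0) * (x (Nat.log 2 n - 1 - k)).val)

/-- The `d`-dimensional Walsh–Kaczmarz function. -/
def kaczD (d : ℕ) (m : Fin d → ℕ) (x : Fin d → WG) : ℝ := ∏ i, kacz (m i) (x i)

/-- Walsh–Paley Dirichlet kernel. -/
def dirW (n : ℕ) (x : WG) : ℝ := ∑ k ∈ Finset.range n, walsh k x

/-- Walsh–Kaczmarz Dirichlet kernel. -/
def dirK (n : ℕ) (x : WG) : ℝ := ∑ k ∈ Finset.range n, kacz k x

/-- `A_j^α = binom (j+α) j`. -/
def Abin (α : ℝ) (j : ℕ) : ℝ := ∏ i ∈ Finset.range j, (α + i + 1) / (i + 1)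

/-- One-dimensional Walsh–Paley `(C,α)` kernel. -/
def KW (α : ℝ) (n : ℕ) (x : WG) : ℝ :=
  (Abin α n)⁻¹ * ∑ k ∈ Finset.range (n + 1), Abin (α - 1) (n - k) * dirW k x

/-- One-dimensional Walsh–Kaczmarz `(C,α)` kernel. -/
def KK (α : ℝ) (n : ℕ) (x : WG) : ℝ :=
  (Abin α n)⁻¹ * ∑ k ∈ Finset.range (n + 1), Abin (α - 1) (n - k) * dirK k x

/-- The `m`-th Walsh–Kaczmarz–Fourier coefficient of `f : G^d → ℝ`. -/
def fCoeff (d : ℕ) (f : (Fin d → WG) → ℝ) (m : Fin d → ℕ) : ℝ :=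
  ∫ x, f x * kaczD d m x ∂ μD d

/-- Rectangular partial sum built from an abstract family `c` of Fourier coefficients. -/
def partialSumOf (d : ℕ) (c : (Fin d → ℕ) → ℝ) (k : Fin d → ℕ) (x : Fin d → WG) : ℝ :=
  ∑ m ∈ Fintype.piFinset (fun i => Finset.range (k i)), c m * kaczD d m x

/-- `(C,α)` (Cesàro) mean of order `n` built from coefficients `c`. -/
def cesaroOf (d : ℕ) (α : Fin d → ℝ) (c : (Fin d → ℕ) → ℝ) (n : Fin d → ℕ)
    (x : Fin d → WG) : ℝ :=
  (∏ i, Abin (α i) (n i))⁻¹ *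
    ∑ k ∈ Fintype.piFinset (fun i => Finset.range (n i + 1)),
      (∏ i, Abin (α i - 1) (n i - k i)) * partialSumOf d c k x

/-- A cone-like restriction function (CRF) family `γ = (γ_j)_{j ≠ 0}`. -/
structure IsCRF (d : ℕ) [NeZero d] (γ : Fin d → ℝ → ℝ) : Prop where
  strictMono : ∀ j : Fin d, j ≠ 0 → StrictMonoOn (γ j) (Set.Ici 1)
  contOn : ∀ j : Fin d, j ≠ 0 → ContinuousOn (γ j) (Set.Ici 1)
  one_le : ∀ j : Fin d, j ≠ 0 → ∀ x : ℝ, 1 ≤ x → 1 ≤ γ j x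
  map_one : ∀ j : Fin d, j ≠ 0 → γ j 1 = 1
  tendsto_atTop : ∀ j : Fin d, j ≠ 0 → Tendsto (γ j) atTop atTop
  reg : ∃ ζ : ℝ, 1 < ζ ∧ ∀ j : Fin d, j ≠ 0 → ∃ c₁ c₂ : ℝ, 1 < c₁ ∧ 1 < c₂ ∧
    ∀ x : ℝ, 1 ≤ x → c₁ * γ j x ≤ γ j (ζ * x) ∧ γ j (ζ * x) ≤ c₂ * γ j x

/-- The cone-like set `L` determined by `γ` and the parameters `β`. -/
def coneLike (d : ℕ) [NeZero d] (γ : Fin d → ℝ → ℝ) (β : Fin d → ℝ) : Set (Fin d → ℕ) :=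
  {n | ∀ j : Fin d, j ≠ 0 → (β j)⁻¹ * γ j (n 0) ≤ (n j : ℝ) ∧ (n j : ℝ) ≤ β j * γ j (n 0)}

/-- `bar γ n₁ = (n₁, n₂, …, n_d)` where `n_j = |γ_j(2^{n₁})|` is the order of `γ_j(2^{n₁})`,
i.e. `2^{n_j} ≤ γ_j(2^{n₁}) < 2^{n_j+1}`. -/
def bar (d : ℕ) [NeZero d] (γ : Fin d → ℝ → ℝ) (n₁ : ℕ) : Fin d → ℕ :=
  fun j => if j = 0 then n₁ else Nat.log 2 ⌊γ j ((2 : ℝ) ^ n₁)⌋₊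

/-- The cone-like restricted maximal operator `σ_L^{κ,α,*}` (built from coefficients `c`). -/
def cesaroMaximal (d : ℕ) [NeZero d] (α : Fin d → ℝ) (γ : Fin d → ℝ → ℝ) (β : Fin d → ℝ)
    (c : (Fin d → ℕ) → ℝ) (x : Fin d → WG) : ℝ≥0∞ :=
  ⨆ n ∈ coneLike d γ β, ENNReal.ofReal |cesaroOf d α c n x|

/-- `L^p`-"norm" (`0 < p < ∞`) of an `ℝ≥0∞`-valued function on `G^d`. -/
def lpNormE (d : ℕ) (p : ℝ) (g : (Fin d → WG) → ℝ≥0∞) : ℝ≥0∞ :=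
  (∫⁻ x, g x ^ p ∂ μD d) ^ (1 / p)

/-- The dyadic rectangle `I_{N}(y) = I_{N_1}(y^1) × ⋯ × I_{N_d}(y^d)`. -/
def rectAt (d : ℕ) (N : Fin d → ℕ) (y : Fin d → WG) : Set (Fin d → WG) :=
  {x | ∀ j : Fin d, ∀ i : ℕ, i < N j → x j i = y j i}

/-- The one-dimensional dyadic interval `I_N = I_N(0)`. -/
def rectW (N : ℕ) : Set WG := {x | ∀ i : ℕ, i < N → x i = 0}

/-- A one-parameter martingale with respect to the filtration
`(F_{bar γ n₁})_{n₁}` generated by the dyadic rectangles `I_{bar γ n₁}(y)`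
(measurability w.r.t. this atomic σ-algebra = being constant on its rectangles,
and the martingale property = equality of integrals over the rectangles). -/
structure ConeMartingale (d : ℕ) [NeZero d] (γ : Fin d → ℝ → ℝ) where
  F : ℕ → (Fin d → WG) → ℝ
  integrable : ∀ n₁, Integrable (F n₁) (μD d)
  adapted : ∀ n₁ (x y : Fin d → WG),
    (∀ j : Fin d, ∀ i : ℕ, i < bar d γ n₁ j → x j i = y j i) → F n₁ x = F n₁ y
  mart : ∀ n₁ m₁, n₁ ≤ m₁ → ∀ y,
    ∫ x in rectAt d (bar d γ n₁) y, F m₁ x ∂ μD d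
      = ∫ x in rectAt d (bar d γ n₁) y, F n₁ x ∂ μD d

/-- The Fourier coefficients of a martingale (the integrals `∫ f_k ψ_m` stabilize). -/
def martCoeff (d : ℕ) [NeZero d] (γ : Fin d → ℝ → ℝ) (f : ConeMartingale d γ) (m : Fin d → ℕ) : ℝ :=
  limUnder atTop (fun k => ∫ x, f.F k x * kaczD d m x ∂ μD d)

/-- The maximal function `f* = sup_{n₁} |f_{bar n₁}|` of a martingale. -/
def martMaximal (d : ℕ) [NeZero d] (γ : Fin d → ℝ → ℝ) (f : ConeMartingale d γ)
    (x : Fin d → WG) : ℝ≥0∞ :=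
  ⨆ n₁ : ℕ, ENNReal.ofReal |f.F n₁ x|

/-- The martingale Hardy space "norm" `‖f‖_{H_p^γ} = ‖f*‖_p`. -/
def hardyNorm (d : ℕ) [NeZero d] (γ : Fin d → ℝ → ℝ) (p : ℝ) (f : ConeMartingale d γ) : ℝ≥0∞ :=
  lpNormE d p (martMaximal d γ f)

/-- A `p`-atom supported on the rectangle `I_N(y)`. -/
structure IsPAtom (d : ℕ) (p : ℝ) (a : (Fin d → WG) → ℝ) (N : Fin d → ℕ)
    (y : Fin d → WG) : Prop where
  measurable : Measurable a
  support : ∀ x, x ∉ rectAt d N y → a x = 0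
  bound : ∀ x, |a x| ≤ ((μD d (rectAt d N y)).toReal) ^ (-(1 / p))
  zero : ∫ x, a x ∂ μD d = 0

/-- The conditional-expectation (dyadic average) of `f` at level `N`. -/
def avgAt (d : ℕ) (N : Fin d → ℕ) (f : (Fin d → WG) → ℝ) (x : Fin d → WG) : ℝ :=
  (2 : ℝ) ^ (∑ j, N j) * ∫ t in rectAt d N x, f t ∂ μD d

/-- `m` is the martingale generated by the integrable function `f`. -/
def inducedLevels (d : ℕ) [NeZero d] (γ : Fin d → ℝ → ℝ) (f : (Fin d → WG) → ℝ)
    (m : ConeMartingale d γ) : Prop :=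
  ∀ n₁ x, m.F n₁ x = avgAt d (bar d γ n₁) f x

/-- The martingale maximal function of (the martingale generated by) a function `f`,
`f* = sup_{n₁} |S_{2^{bar γ n₁}} f|`. -/
def funMaximal (d : ℕ) [NeZero d] (γ : Fin d → ℝ → ℝ) (f : (Fin d → WG) → ℝ)
    (x : Fin d → WG) : ℝ≥0∞ :=
  ⨆ n₁ : ℕ, ENNReal.ofReal |partialSumOf d (fCoeff d f) (fun j => 2 ^ bar d γ n₁ j) x|

/-- The Hardy norm `‖f‖_{H_p^γ}` of (the martingale generated by) a function `f`. -/
def funHardyNorm (d : ℕ) [NeZero d] (γ : Fin d → ℝ → ℝ) (p : ℝ) (f : (Fin d → WG) → ℝ) : ℝ≥0∞ :=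
  lpNormE d p (funMaximal d γ f)

/-- Skvortsov's bit-reversal transformation `τ_A`. -/
def tau (A : ℕ) (x : WG) : WG := fun i => if i < A then x (A - 1 - i) else x i

end

noncomputable section

/-- The counterexample function
`f_{n̄₁}(x) = (D_{2^{n₁+1}}(x¹) - D_{2^{n₁}}(x¹)) ∏_{j≠0} w_{2^{n_j}-1}(x^j)`,
where `n_j = bar γ n₁ j` is the order of `γ_j(2^{n₁})`. -/
def counterF (d : ℕ) [NeZero d] (γ : Fin d → ℝ → ℝ) (n₁ : ℕ) (x : Fin d → WG) : ℝ :=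
  (dirW (2 ^ (n₁ + 1)) (x 0) - dirW (2 ^ n₁) (x 0)) *
    ∏ j ∈ Finset.univ.erase 0, walsh (2 ^ (bar d γ n₁ j) - 1) (x j)

instance : IsProbabilityMeasure μW := by
  constructor
  rw [← TopologicalSpace.PositiveCompacts.coe_top (α := WG)]
  exact Measure.addHaarMeasure_self

instance : μW.IsAddLeftInvariant := by unfold μW; infer_instance

lemma rad_add (k : ℕ) (x y : WG) : rad k (x + y) = rad k x * rad k y := by
  have h : ∀ a b : ZMod 2, (-1 : ℝ) ^ (a + b).val = (-1) ^ a.val * (-1) ^ b.val := by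
    intro a b
    rw [← pow_add, ZMod.val_add, ← neg_one_pow_eq_pow_mod_two]
  exact h _ _

lemma rad_single (k i : ℕ) : rad k (Pi.single i 1) = if k = i then -1 else 1 := by
  by_cases h : k = i
  · subst h
    simp [rad, ZMod.val_one]
  · simp [rad, h]

lemma rad_mul_self (k : ℕ) (x : WG) : rad k x * rad k x = 1 := by
  simp [rad, ← mul_pow]

lemma continuous_rad (k : ℕ) : Continuous (rad k) :=
  (continuous_of_discreteTopology (f := fun a : ZMod 2 => (-1 : ℝ) ^ a.val)).comp
    (continuous_apply k)

lemma kacz_zero (x : WG) : kacz 0 x = 1 := by simp [kacz]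

lemma kacz_two_pow_add {n k : ℕ} (hk : k < 2 ^ n) (x : WG) :
    kacz (2 ^ n + k) x =
      rad n x * ∏ i ∈ Finset.range n, if k.testBit i then rad (n - 1 - i) x else 1 := by
  have hlog : Nat.log 2 (2 ^ n + k) = n :=
    Nat.log_eq_of_pow_le_of_lt_pow (by omega) (by rw [pow_succ]; omega)
  have hpos : 2 ^ n + k ≠ 0 := by positivity
  rw [kacz, if_neg hpos, hlog, ← Finset.prod_pow_eq_pow_sum]
  congr 1
  refine Finset.prod_congr rfl fun i hi => ?_
  rw [Nat.testBit_two_pow_add_gt (Finset.mem_range.1 hi)]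
  by_cases h : k.testBit i <;> simp [h, rad]

lemma exists_eq_two_pow_add {m : ℕ} (hm : m ≠ 0) : ∃ n k, k < 2 ^ n ∧ m = 2 ^ n + k := by
  have h₁ := Nat.pow_log_le_self 2 hm
  have h₂ := Nat.lt_pow_succ_log_self (b := 2) (by norm_num) m
  rw [pow_succ] at h₂
  exact ⟨Nat.log 2 m, m - 2 ^ Nat.log 2 m, by omega, by omega⟩

lemma kacz_add (m : ℕ) (x y : WG) : kacz m (x + y) = kacz m x * kacz m y := by
  rcases eq_or_ne m 0 with rfl | hm
  · simp [kacz_zero]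
  obtain ⟨n, k, hk, rfl⟩ := exists_eq_two_pow_add hm
  simp only [kacz_two_pow_add hk, rad_add]
  rw [mul_mul_mul_comm, ← Finset.prod_mul_distrib]
  congr 1
  refine Finset.prod_congr rfl fun i _ => ?_
  split_ifs <;> simp

lemma kacz_mul_self (m : ℕ) (x : WG) : kacz m x * kacz m x = 1 := by
  rcases eq_or_ne m 0 with rfl | hm
  · simp [kacz_zero]
  rw [kacz, if_neg hm, mul_mul_mul_comm, rad_mul_self, ← mul_pow]
  simp

lemma continuous_kacz (m : ℕ) : Continuous (kacz m) := by
  rcases eq_or_ne m 0 with rfl | hm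
  · simpa only [funext kacz_zero] using continuous_const
  obtain ⟨n, k, hk, rfl⟩ := exists_eq_two_pow_add hm
  rw [funext (kacz_two_pow_add hk)]
  refine (continuous_rad n).mul (continuous_finsetProd _ fun i _ => ?_)
  split_ifs
  exacts [continuous_rad _, continuous_const]

lemma kacz_single_top {n k : ℕ} (hk : k < 2 ^ n) : kacz (2 ^ n + k) (Pi.single n 1) = -1 := by
  rw [kacz_two_pow_add hk, rad_single, if_pos rfl, Finset.prod_eq_one, mul_one]
  intro i hi
  have h : n - 1 - i ≠ n := by have := Finset.mem_range.1 hi; omega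
  rw [rad_single, if_neg h, ite_self]

lemma kacz_single_of_lt {m n : ℕ} (hm : m < 2 ^ n) : kacz m (Pi.single n 1) = 1 := by
  rcases eq_or_ne m 0 with rfl | h
  · exact kacz_zero _
  obtain ⟨l, k, hk, rfl⟩ := exists_eq_two_pow_add h
  have hl : l < n := (Nat.pow_lt_pow_iff_right (a := 2) (by norm_num)).1 (by omega)
  rw [kacz_two_pow_add hk, rad_single, if_neg hl.ne, one_mul, Finset.prod_eq_one]
  intro i _
  have h : l - 1 - i ≠ n := by omega
  rw [rad_single, if_neg h, ite_self]

lemma kacz_single_reflect {n k i : ℕ} (hk : k < 2 ^ n) (hi : i < n) :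
    kacz (2 ^ n + k) (Pi.single (n - 1 - i) 1) = if k.testBit i then -1 else 1 := by
  rw [kacz_two_pow_add hk, rad_single, if_neg (by omega), one_mul,
    Finset.prod_eq_single_of_mem i (Finset.mem_range.2 hi), rad_single, if_pos rfl]
  intro j hj hji
  have h : n - 1 - j ≠ n - 1 - i := by have := Finset.mem_range.1 hj; omega
  rw [rad_single, if_neg h, ite_self]

lemma exists_kacz_mul_kacz_eq_neg_one {m m' : ℕ} (h : m < m') :
    ∃ a : WG, kacz m a * kacz m' a = -1 := by
  obtain ⟨n, k', hk', rfl⟩ := exists_eq_two_pow_add (by omega : m' ≠ 0)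
  by_cases hm : m < 2 ^ n
  · exact ⟨Pi.single n 1, by rw [kacz_single_of_lt hm, kacz_single_top hk', one_mul]⟩
  obtain ⟨k, rfl⟩ := Nat.exists_eq_add_of_le (not_lt.1 hm)
  have hk : k < 2 ^ n := by omega
  obtain ⟨i, hi⟩ := Nat.exists_testBit_ne_of_ne (by omega : k ≠ k')
  have hin : i < n := by
    by_contra! hni
    have := Nat.pow_le_pow_right (n := 2) (by norm_num) hni
    exact hi (by rw [Nat.testBit_lt_two_pow (hk.trans_le this),
      Nat.testBit_lt_two_pow (hk'.trans_le this)])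
  refine ⟨Pi.single (n - 1 - i) 1, ?_⟩
  rw [kacz_single_reflect hk hin, kacz_single_reflect hk' hin]
  revert hi
  cases k.testBit i <;> cases k'.testBit i <;> simp

lemma integral_kacz_mul_kacz (m m' : ℕ) :
    ∫ x, kacz m x * kacz m' x ∂μW = if m = m' then 1 else 0 := by
  rcases eq_or_ne m m' with rfl | h
  · simp [kacz_mul_self]
  obtain ⟨a, ha⟩ : ∃ a : WG, kacz m a * kacz m' a = -1 := by
    rcases h.lt_or_gt with h | h
    · exact exists_kacz_mul_kacz_eq_neg_one h
    · simpa only [mul_comm] using exists_kacz_mul_kacz_eq_neg_one h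
  have key := integral_add_left_eq_self (μ := μW) (fun x => kacz m x * kacz m' x) a
  have hshift (x : WG) : kacz m (a + x) * kacz m' (a + x) = -(kacz m x * kacz m' x) := by
    rw [kacz_add, kacz_add, mul_mul_mul_comm, ha, neg_one_mul]
  simp only [hshift, integral_neg] at key
  rw [if_neg h]
  linarith

lemma integrable_kaczD_mul_kaczD (d : ℕ) (m m' : Fin d → ℕ) :
    Integrable (fun x => kaczD d m x * kaczD d m' x) (μD d) := by
  simp only [kaczD, ← Finset.prod_mul_distrib]
  refine Integrable.fintype_prod (f := fun i y => kacz (m i) y * kacz (m' i) y) fun i => ?_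
  exact ((continuous_kacz _).mul (continuous_kacz _)).integrable_of_hasCompactSupport
    (HasCompactSupport.of_compactSpace _)

lemma integral_kaczD_mul_kaczD (d : ℕ) (m m' : Fin d → ℕ) :
    ∫ x, kaczD d m x * kaczD d m' x ∂μD d = if m = m' then 1 else 0 := by
  simp only [kaczD, ← Finset.prod_mul_distrib, μD]
  rw [integral_fintype_prod_eq_prod (fun i y => kacz (m i) y * kacz (m' i) y)]
  simp only [integral_kacz_mul_kacz, funext_iff]
  rw [Finset.prod_ite_zero]
  simp

lemma fCoeff_sum_kaczD (d : ℕ) (s : Finset (Fin d → ℕ)) (m : Fin d → ℕ) :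
    fCoeff d (fun x => ∑ k ∈ s, kaczD d k x) m = if m ∈ s then 1 else 0 := by
  simp only [fCoeff, Finset.sum_mul]
  rw [integral_finsetSum _ fun k _ => integrable_kaczD_mul_kaczD d k m]
  simp [integral_kaczD_mul_kaczD]

lemma partialSumOf_sum_kaczD (d : ℕ) (s : Finset (Fin d → ℕ)) (j : Fin d → ℕ)
    (x : Fin d → WG) :
    partialSumOf d (fCoeff d fun y => ∑ k ∈ s, kaczD d k y) j x =
      ∑ m ∈ Fintype.piFinset (fun i => Finset.range (j i)) ∩ s, kaczD d m x := by
  simp [partialSumOf, fCoeff_sum_kaczD]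

lemma sum_range_two_pow_succ (n : ℕ) (f : ℕ → ℝ) :
    ∑ k ∈ Finset.range (2 ^ (n + 1)), f k =
      ∑ k ∈ Finset.range (2 ^ n), f k + ∑ k ∈ Finset.range (2 ^ n), f (2 ^ n + k) := by
  rw [pow_succ, mul_two, Finset.sum_range_add]

lemma sum_prod_testBit (a : ℕ → ℝ) (n : ℕ) :
    ∑ k ∈ Finset.range (2 ^ n), ∏ i ∈ Finset.range n, (if k.testBit i then a i else 1) =
      ∏ i ∈ Finset.range n, (1 + a i) := by
  induction n with
  | zero => simp
  | succ n ih =>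
    rw [sum_range_two_pow_succ, Finset.prod_range_succ _ n, ← ih, mul_add, mul_one,
      Finset.sum_mul]
    congr 1 <;> refine Finset.sum_congr rfl fun k hk => ?_
    all_goals
      have hk := Nat.testBit_lt_two_pow (Finset.mem_range.1 hk)
      rw [Finset.prod_range_succ]
    · simp [hk]
    · rw [Nat.testBit_two_pow_add_eq, hk]
      congr 1
      refine Finset.prod_congr rfl fun i hi => ?_
      rw [Nat.testBit_two_pow_add_gt (Finset.mem_range.1 hi)]

lemma walsh_eq_prod {n k : ℕ} (hk : k < 2 ^ n) (x : WG) :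
    walsh k x = ∏ i ∈ Finset.range n, if k.testBit i then rad i x else 1 := by
  refine Finset.prod_subset (Finset.range_mono (Nat.size_le.2 hk)) fun i _ hi => ?_
  have : k < 2 ^ i := Nat.size_le.1 (by simpa using hi)
  simp [Nat.testBit_lt_two_pow this]

lemma dirW_two_pow (n : ℕ) (x : WG) :
    dirW (2 ^ n) x = ∏ i ∈ Finset.range n, (1 + rad i x) := by
  rw [← sum_prod_testBit]
  exact Finset.sum_congr rfl fun k hk => walsh_eq_prod (Finset.mem_range.1 hk) x

lemma dirK_two_pow (n : ℕ) (x : WG) : dirK (2 ^ n) x = dirW (2 ^ n) x := by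
  rw [dirW_two_pow]
  induction n with
  | zero => simp [dirK, kacz_zero]
  | succ n ih =>
    rw [dirK, sum_range_two_pow_succ, Finset.prod_range_succ, ← ih, dirK, mul_add, mul_one]
    congr 1
    rw [← dirK, ih, Finset.sum_congr rfl fun k hk =>
      kacz_two_pow_add (Finset.mem_range.1 hk) x, ← Finset.mul_sum,
      sum_prod_testBit (fun i => rad (n - 1 - i) x),
      Finset.prod_range_reflect (fun i => 1 + rad i x), mul_comm]

lemma walsh_two_pow_sub_one (n : ℕ) (x : WG) : walsh (2 ^ n - 1) x = kacz (2 ^ n - 1) x := by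
  have hn : 2 ^ n - 1 < 2 ^ n := Nat.sub_lt (by positivity) one_pos
  rw [walsh_eq_prod hn]
  cases n with
  | zero => simp [kacz_zero]
  | succ n =>
    have hpos : 0 < 2 ^ n := by positivity
    have h : 2 ^ (n + 1) - 1 = 2 ^ n + (2 ^ n - 1) := by rw [pow_succ]; omega
    rw [h, kacz_two_pow_add (by omega), ← h, Finset.prod_range_succ, mul_comm,
      ← Finset.prod_range_reflect (fun i =>
        if Nat.testBit (2 ^ (n + 1) - 1) i then rad i x else 1) n]
    congr 1
    · simp
    · refine Finset.prod_congr rfl fun i hi => ?_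
      have := Finset.mem_range.1 hi
      rw [Nat.testBit_two_pow_sub_one, Nat.testBit_two_pow_sub_one, if_pos, if_pos] <;>
        · rw [decide_eq_true_eq]; omega

/-- A finite box of indices which is arbitrary in the zeroth coordinate and a point in all the
others. -/
def indexLine (d : ℕ) (s : Finset ℕ) (b : Fin (d + 1) → ℕ) : Finset (Fin (d + 1) → ℕ) :=
  s.image fun k => Function.update b 0 k

lemma sum_indexLine_kaczD (d : ℕ) (s : Finset ℕ) (b : Fin (d + 1) → ℕ)
    (x : Fin (d + 1) → WG) :
    ∑ m ∈ indexLine d s b, kaczD (d + 1) m x =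
      (∑ k ∈ s, kacz k (x 0)) * ∏ l ∈ Finset.univ.erase 0, kacz (b l) (x l) := by
  rw [indexLine, Finset.sum_image fun _ _ _ _ h => Function.update_injective b 0 h,
    Finset.sum_mul]
  refine Finset.sum_congr rfl fun k _ => ?_
  rw [kaczD, ← Finset.mul_prod_erase _ _ (Finset.mem_univ 0), Function.update_self]
  congr 1
  refine Finset.prod_congr rfl fun l hl => ?_
  rw [Function.update_of_ne (Finset.ne_of_mem_erase hl)]

lemma piFinset_inter_indexLine (d : ℕ) (s : Finset ℕ) (b j : Fin (d + 1) → ℕ) :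
    Fintype.piFinset (fun i => Finset.range (j i)) ∩ indexLine d s b =
      indexLine d (s.filter fun k => k < j 0 ∧ ∀ l, l ≠ 0 → b l < j l) b := by
  ext m
  simp only [indexLine, Finset.mem_inter, Fintype.mem_piFinset, Finset.mem_range,
    Finset.mem_image, Finset.mem_filter]
  have key (k : ℕ) : (∀ i, Function.update b 0 k i < j i) ↔
      k < j 0 ∧ ∀ l, l ≠ 0 → b l < j l :=
    Function.forall_update_iff b fun i y => y < j i
  constructor
  · rintro ⟨hm, k, hk, rfl⟩
    exact ⟨k, ⟨hk, (key k).1 hm⟩, rfl⟩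
  · rintro ⟨k, ⟨hk, hj⟩, rfl⟩
    exact ⟨(key k).2 hj, k, hk, rfl⟩

lemma sum_Ico_kacz {n N : ℕ} (h : 2 ^ n ≤ N) (x : WG) :
    ∑ k ∈ Finset.Ico (2 ^ n) N, kacz k x = dirK N x - dirW (2 ^ n) x := by
  rw [Finset.sum_Ico_eq_sub _ h, ← dirK_two_pow, dirK, dirK]

lemma counterF_eq_sum_kaczD (d : ℕ) (γ : Fin (d + 1) → ℝ → ℝ) (n₁ : ℕ) :
    counterF (d + 1) γ n₁ = fun x =>
      ∑ m ∈ indexLine d (Finset.Ico (2 ^ n₁) (2 ^ (n₁ + 1)))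
        (fun l => 2 ^ bar (d + 1) γ n₁ l - 1), kaczD (d + 1) m x := by
  ext x
  rw [sum_indexLine_kaczD, sum_Ico_kacz (Nat.pow_le_pow_right (by norm_num) n₁.le_succ),
    dirK_two_pow]
  simp only [counterF, walsh_two_pow_sub_one]

open Classical in
/-- the rectangular Walsh–Kaczmarz partial sums of the counterexample
`f_{n̄₁}` are `(D^κ_{j₁} - D_{2^{n₁}}) ∏_{l≠0} w_{2^{n_l}-1}` for
`2^{n₁}+1 ≤ j₁ ≤ 2^{n₁+1}-1` and `j_l ≥ 2^{n_l}`; equal to `f_{n̄₁}` for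
`j₁ ≥ 2^{n₁+1}` and `j_l ≥ 2^{n_l}`; and `0` otherwise. -/
theorem counterexample_partial_sums
    (d : ℕ) (γ : Fin (d + 1) → ℝ → ℝ) (hγ : IsCRF (d + 1) γ) (n₁ : ℕ)
    (j : Fin (d + 1) → ℕ) (x : Fin (d + 1) → WG) :
    partialSumOf (d + 1) (fCoeff (d + 1) (counterF (d + 1) γ n₁)) j x =
      if 2 ^ n₁ + 1 ≤ j 0 ∧ j 0 ≤ 2 ^ (n₁ + 1) - 1 ∧
          (∀ l : Fin (d + 1), l ≠ 0 → 2 ^ (bar (d + 1) γ n₁ l) ≤ j l)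
      then (dirK (j 0) (x 0) - dirW (2 ^ n₁) (x 0)) *
            ∏ l ∈ Finset.univ.erase 0, walsh (2 ^ (bar (d + 1) γ n₁ l) - 1) (x l)
      else if 2 ^ (n₁ + 1) ≤ j 0 ∧
          (∀ l : Fin (d + 1), l ≠ 0 → 2 ^ (bar (d + 1) γ n₁ l) ≤ j l)
      then counterF (d + 1) γ n₁ x
      else 0 := by
  have hpow (l : Fin (d + 1)) : 2 ^ bar (d + 1) γ n₁ l - 1 < j l ↔
      2 ^ bar (d + 1) γ n₁ l ≤ j l := by
    have : 0 < 2 ^ bar (d + 1) γ n₁ l := by positivity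
    omega
  have hlt : 2 ^ n₁ < 2 ^ (n₁ + 1) := Nat.pow_lt_pow_right (by norm_num) n₁.lt_succ_self
  rw [counterF_eq_sum_kaczD, partialSumOf_sum_kaczD, piFinset_inter_indexLine,
    sum_indexLine_kaczD]
  simp only [hpow, walsh_two_pow_sub_one, sum_indexLine_kaczD]
  by_cases hj : ∀ l : Fin (d + 1), l ≠ 0 → 2 ^ bar (d + 1) γ n₁ l ≤ j l
  · have hfilter : (Finset.Ico (2 ^ n₁) (2 ^ (n₁ + 1))).filter
        (fun k => k < j 0 ∧ ∀ l : Fin (d + 1), l ≠ 0 → 2 ^ bar (d + 1) γ n₁ l ≤ j l) =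
        Finset.Ico (2 ^ n₁) (min (2 ^ (n₁ + 1)) (j 0)) := by
      ext k
      simp only [Finset.mem_filter, Finset.mem_Ico, lt_min_iff, and_iff_left hj, and_assoc]
    rw [hfilter]
    split_ifs with h₁ h₂
    · rw [min_eq_right (by omega), sum_Ico_kacz (by omega)]
    · rw [min_eq_left h₂.1]
    · have : j 0 ≤ 2 ^ n₁ := by
        by_contra! h
        by_cases h' : 2 ^ (n₁ + 1) ≤ j 0
        · exact h₂ ⟨h', hj⟩
        · exact h₁ ⟨by omega, by omega, hj⟩
      rw [Finset.Ico_eq_empty (by simp [this]), Finset.sum_empty, zero_mul]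
  · rw [if_neg fun h => hj h.2.2, if_neg fun h => hj h.2,
      Finset.filter_false_of_mem fun k _ h => hj h.2, Finset.sum_empty, zero_mul]

end
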